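/- Fix M > 0, r ∈ (1/2, 1] and n ∈ ℕ. There exists a constant D_n > 0 (depending only on n, M, r) such that: for every C^∞ map f : 𝕋¹ → Ω(closure D(0,r)) with ‖f‖_0 ≤ M and every C^∞ function u : 𝕋¹ → ℂ with ‖u‖_0 < 1/2, the composed function θ ↦ f(θ, u(θ)) is C^∞ from 𝕋¹ to ℂ and satisfies the tame estimate ‖θ ↦ f(θ,u(θ))‖_n ≤ D_n (1 + ‖f‖_n + ‖u‖_n). -/

import Mathlib

open MeasureTheory Metric Complex Real Set Function

noncomputable section

/-- Distance from a real number to the nearest integer. -/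
def distInt (x : ℝ) : ℝ := ⨅ p : ℤ, |x - (p : ℝ)|

/-- The Diophantine condition CD on a real number. -/
def IsCD (α : ℝ) : Prop :=
  Irrational α ∧ ∃ c : ℝ, 0 < c ∧ ∃ τ : ℝ, 0 ≤ τ ∧
    ∀ N : ℕ, 1 ≤ N → c / (N : ℝ) ^ (1 + τ) ≤ distInt (N * α)

/-- The Diophantine condition CD₁ on a pair of real numbers. -/
def IsCD1 (α β : ℝ) : Prop :=
  Irrational α ∧ ∃ c : ℝ, 0 < c ∧ ∃ τ : ℝ, 0 ≤ τ ∧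
    (∀ N : ℕ, 1 ≤ N → c / (N : ℝ) ^ (1 + τ) ≤ distInt (N * α)) ∧
    (∀ N : ℤ, N ≠ 0 → c / |(N : ℝ)| ^ (1 + τ) ≤ distInt (N * α - β))

/-- The C^r norm of a smooth Banach-space-valued function on the circle. -/
def cNorm {E : Type*} [NormedAddCommGroup E] [NormedSpace ℝ E] (r : ℕ) (g : ℝ → E) : ℝ :=
  ∑ i ∈ Finset.range (r + 1), ⨆ θ : ℝ, ‖iteratedDeriv i g θ‖

/-- C^∞ and ℤ-periodic : a smooth function on the circle 𝕋¹ = ℝ/ℤ. -/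
def SmoothPer {E : Type*} [NormedAddCommGroup E] [NormedSpace ℝ E] (g : ℝ → E) : Prop :=
  ContDiff ℝ (⊤ : ℕ∞) g ∧ Function.Periodic g 1

/-- Fourier coefficients of a function on the circle. -/
def fourierCoef (φ : ℝ → ℂ) (n : ℤ) : ℂ :=
  ∫ θ in (0:ℝ)..1, φ θ * Complex.exp (-(2 * π * I * n * θ))

/-- The closed disc of radius r in ℂ. -/
abbrev OmDom (r : ℝ) : Set ℂ := Metric.closedBall (0 : ℂ) r

instance (r : ℝ) : CompactSpace (OmDom r) :=
  isCompact_iff_compactSpace.mp (isCompact_closedBall (0:ℂ) r)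

/-- The Banach space Ω(closure D(0,r)) realized as continuous functions on the closed disc
(holomorphy on the open disc is the predicate `HolOm`), with the sup norm. -/
abbrev Om (r : ℝ) := C(OmDom r, ℂ)

-- Evaluation of an element of Ω at a point of the closed disc (junk value outside).
open scoped Classical in
def evOm {r : ℝ} (g : Om r) (z : ℂ) : ℂ :=
  if h : z ∈ OmDom r then g ⟨z, h⟩ else 0

/-- Holomorphy on the open disc. -/
def HolOm {r : ℝ} (g : Om r) : Prop :=
  DifferentiableOn ℂ (evOm g) (Metric.ball (0:ℂ) r)

/-- The model fiber map z ↦ e^{2πiβ} z as an element of Ω(closure 𝔻). -/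
def lamMap (β : ℝ) : Om 1 :=
  ⟨fun z => Complex.exp (2 * π * I * β) * z.val, by fun_prop⟩

/-- `u` is a C^∞ curve with values in the open unit disc, invariant under the fibered
holomorphic dynamics F(θ,z) = (θ+α, f(θ,z)). -/
def IsInvCurve (α : ℝ) (f : ℝ → Om 1) (u : ℝ → ℂ) : Prop :=
  ContDiff ℝ (⊤ : ℕ∞) u ∧ Function.Periodic u 1 ∧ (∀ θ, ‖u θ‖ < 1) ∧
    ∀ θ, evOm (f θ) (u θ) = u (θ + α)

/-- The curve `u` has degree zero (the derivative along the curve admits a continuous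
logarithm ℓ on 𝕋¹), is indifferent (∫ log|∂_z f(θ,u(θ))| dθ = 0), and its transversal
rotation number (1/2πi)∫ ℓ is β mod 1. -/
def HasRotNum (β : ℝ) (f : ℝ → Om 1) (u : ℝ → ℂ) : Prop :=
  ∃ ℓ : ℝ → ℂ, Continuous ℓ ∧ Function.Periodic ℓ 1 ∧
    (∀ θ, Complex.exp (ℓ θ) = deriv (evOm (f θ)) (u θ)) ∧
    (∫ θ in (0:ℝ)..1, (ℓ θ).re) = 0 ∧
    ∃ m : ℤ, (∫ θ in (0:ℝ)..1, ℓ θ) = 2 * π * I * (β + m)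

/-- Smallest singular value of an ℝ-linear map ℂ → ℂ (ℂ ≅ ℝ²). -/
def minSv (A : ℂ →L[ℝ] ℂ) : ℝ := ⨅ v : Metric.sphere (0:ℂ) 1, ‖A v.val‖

end

theorem le_of_two_mul_sq_le_mul {a : ℕ → ℝ} {n : ℕ} {B : ℝ} (ha : ∀ i, 0 ≤ a i)
    (hconv : ∀ i, i + 2 ≤ n → 2 * a (i + 1) ^ 2 ≤ a i * a (i + 2))
    (h0 : a 0 ≤ B) (hn : a n ≤ B) : ∀ i ≤ n, a i ≤ B := by
  obtain ⟨m, hm, hmax⟩ := Finset.exists_max_image (Finset.range (n + 1)) a ⟨0, by simp⟩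
  simp only [Finset.mem_range, Nat.lt_succ_iff] at hm hmax
  suffices a m ≤ B from fun i hi => (hmax i hi).trans this
  rcases Nat.eq_zero_or_pos m with rfl | hm0
  · exact h0
  rcases hm.eq_or_lt with rfl | hmn
  · exact hn
  obtain ⟨k, rfl⟩ : ∃ k, m = k + 1 := ⟨m - 1, by omega⟩
  have h1 := hconv k (by omega)
  have h2 := hmax k (by omega)
  have h3 := hmax (k + 2) (by omega)
  have h4 : a k * a (k + 2) ≤ a (k + 1) * a (k + 1) := mul_le_mul h2 h3 (ha _) (ha _)
  have h5 : a (k + 1) = 0 := by nlinarith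
  rw [h5]
  exact (ha 0).trans h0

section Interpolation

variable {E : Type*} [NormedAddCommGroup E] [NormedSpace ℝ E]

/-- A form of Landau's inequality on the real line. -/
theorem sq_norm_deriv_le {g g' g'' : ℝ → E} {A B : ℝ}
    (hg : ∀ x, HasDerivAt g (g' x) x) (hg' : ∀ x, HasDerivAt g' (g'' x) x)
    (hA : ∀ x, ‖g x‖ ≤ A) (hB : ∀ x, ‖g'' x‖ ≤ B) (x : ℝ) :
    ‖g' x‖ ^ 2 ≤ 8 * (A * B) := by
  have hA0 : 0 ≤ A := (norm_nonneg _).trans (hA x)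
  have hB0 : 0 ≤ B := (norm_nonneg _).trans (hB x)
  have hlip : ∀ y, ‖g' y - g' x‖ ≤ B * ‖y - x‖ := fun y =>
    convex_univ.norm_image_sub_le_of_norm_hasDerivWithin_le
      (fun z _ => (hg' z).hasDerivWithinAt) (fun z _ => hB z) (mem_univ x) (mem_univ y)
  have key : ∀ h : ℝ, 0 ≤ B * (h * h) + (-‖g' x‖) * h + 2 * A := by
    intro h
    rcases le_total h 0 with hh | hh
    · have := mul_nonneg hB0 (mul_self_nonneg h)
      nlinarith [norm_nonneg (g' x)]
    have hd : ∀ y ∈ Icc x (x + h),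
        HasDerivWithinAt (fun y => g y - y • g' x) (g' y - g' x) (Icc x (x + h)) y := by
      intro y _
      have := (hg y).sub ((hasDerivAt_id y).smul_const (g' x))
      simpa using! this.hasDerivWithinAt
    have hbd : ∀ y ∈ Ico x (x + h), ‖g' y - g' x‖ ≤ B * h := by
      intro y hy
      refine (hlip y).trans ?_
      gcongr
      rw [Real.norm_eq_abs, abs_of_nonneg (by linarith [hy.1])]
      linarith [hy.2]
    have h1 := norm_image_sub_le_of_norm_deriv_le_segment' hd hbd (x + h)
      (right_mem_Icc.2 (by linarith))
    have h2 : h • g' x = g (x + h) - g x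
        - (g (x + h) - (x + h) • g' x - (g x - x • g' x)) := by
      rw [add_smul]; abel
    have h3 : h * ‖g' x‖ ≤ 2 * A + B * h * h := by
      calc h * ‖g' x‖ = ‖h • g' x‖ := by rw [norm_smul, Real.norm_of_nonneg hh]
        _ ≤ ‖g (x + h) - g x‖ + ‖g (x + h) - (x + h) • g' x - (g x - x • g' x)‖ := by
            rw [h2]; exact norm_sub_le _ _
        _ ≤ (A + A) + B * h * (x + h - x) :=
            add_le_add ((norm_sub_le _ _).trans (add_le_add (hA _) (hA _))) h1
        _ = _ := by ring
    linarith
  have := discrim_le_zero key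
  rw [discrim] at this
  linarith

theorem SmoothPer.bddAbove_norm_iteratedDeriv {g : ℝ → E} (hg : SmoothPer g) (i : ℕ) :
    BddAbove (range fun θ => ‖iteratedDeriv i g θ‖) := by
  have hper : Function.Periodic (fun θ => ‖iteratedDeriv i g θ‖) 1 := by
    intro θ
    have h : (fun z => g (z + 1)) = g := funext hg.2
    have := congrFun (iteratedDeriv_comp_add_const i g 1) θ
    simp only [h] at this
    simp only [this]
  have hcont : Continuous (fun θ => ‖iteratedDeriv i g θ‖) :=
    (hg.1.continuous_iteratedDeriv i (by exact_mod_cast le_top)).norm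
  rw [← hper.image_Icc one_pos 0]
  exact (isCompact_Icc.image hcont).bddAbove

theorem SmoothPer.norm_iteratedDeriv_le_iSup {g : ℝ → E} (hg : SmoothPer g) (i : ℕ) (θ : ℝ) :
    ‖iteratedDeriv i g θ‖ ≤ ⨆ θ, ‖iteratedDeriv i g θ‖ :=
  le_ciSup (hg.bddAbove_norm_iteratedDeriv i) θ

theorem iSup_norm_iteratedDeriv_nonneg (g : ℝ → E) (i : ℕ) :
    0 ≤ ⨆ θ, ‖iteratedDeriv i g θ‖ :=
  Real.iSup_nonneg fun _ => norm_nonneg _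

theorem cNorm_nonneg (n : ℕ) (g : ℝ → E) : 0 ≤ cNorm n g :=
  Finset.sum_nonneg fun i _ => iSup_norm_iteratedDeriv_nonneg g i

theorem iSup_norm_iteratedDeriv_le_cNorm (n : ℕ) (g : ℝ → E) :
    ⨆ θ, ‖iteratedDeriv n g θ‖ ≤ cNorm n g :=
  Finset.single_le_sum (f := fun i => ⨆ θ, ‖iteratedDeriv i g θ‖)
    (fun i _ => iSup_norm_iteratedDeriv_nonneg g i) (Finset.self_mem_range_succ n)

/-- Interpolation between the extreme derivatives of a smooth periodic function. -/
theorem SmoothPer.norm_iteratedDeriv_le_of_endpoints {g : ℝ → E} (hg : SmoothPer g)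
    {n : ℕ} {B lam : ℝ} (hlam : 1 ≤ lam)
    (h0 : ⨆ θ, ‖iteratedDeriv 0 g θ‖ ≤ B) (hn : ⨆ θ, ‖iteratedDeriv n g θ‖ ≤ B * lam ^ n)
    {i : ℕ} (hi : i ≤ n) (θ : ℝ) :
    ‖iteratedDeriv i g θ‖ ≤ 4 ^ n ^ 2 * B * lam ^ i := by
  have hlam0 : 0 < lam := by linarith
  have hB : 0 ≤ B := (iSup_norm_iteratedDeriv_nonneg g 0).trans h0
  set m : ℕ → ℝ := fun i => ⨆ θ, ‖iteratedDeriv i g θ‖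
  have hm0 : ∀ i, 0 ≤ m i := iSup_norm_iteratedDeriv_nonneg g
  have hderiv : ∀ i x, HasDerivAt (iteratedDeriv i g) (iteratedDeriv (i + 1) g x) x := by
    intro i x
    rw [iteratedDeriv_succ]
    exact (hg.1.differentiable_iteratedDeriv i
      (by exact_mod_cast WithTop.coe_lt_top (i : ℕ))).differentiableAt.hasDerivAt
  have hlandau : ∀ i, m (i + 1) ^ 2 ≤ 8 * (m i * m (i + 2)) := by
    intro i
    have hnn : 0 ≤ 8 * (m i * m (i + 2)) := by have := hm0 i; have := hm0 (i + 2); positivity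
    refine (Real.le_sqrt (hm0 _) hnn).1 (ciSup_le fun x => Real.le_sqrt_of_sq_le ?_)
    exact sq_norm_deriv_le (hderiv i) (hderiv (i + 1)) (hg.norm_iteratedDeriv_le_iSup i)
      (hg.norm_iteratedDeriv_le_iSup (i + 2)) x
  have hbound := le_of_two_mul_sq_le_mul (a := fun i => 4 ^ i ^ 2 * (m i / lam ^ i)) (n := n)
    (B := 4 ^ n ^ 2 * B) (fun i => by have := hm0 i; positivity) ?_ ?_ ?_ i hi
  · have h1 : m i / lam ^ i ≤ 4 ^ i ^ 2 * (m i / lam ^ i) :=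
      le_mul_of_one_le_left (div_nonneg (hm0 i) (by positivity)) (one_le_pow₀ (by norm_num))
    exact (hg.norm_iteratedDeriv_le_iSup i θ).trans
      ((div_le_iff₀ (by positivity)).1 (h1.trans hbound))
  · intro i _
    have h1 := hlandau i
    have e1 : (4 : ℝ) ^ i ^ 2 * (m i / lam ^ i) * (4 ^ (i + 2) ^ 2 * (m (i + 2) / lam ^ (i + 2)))
        = 16 * (4 ^ (i + 1) ^ 2 / lam ^ (i + 1)) ^ 2 * (m i * m (i + 2)) := by
      field_simp
      ring
    have e2 : 2 * ((4 : ℝ) ^ (i + 1) ^ 2 * (m (i + 1) / lam ^ (i + 1))) ^ 2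
        = 2 * (4 ^ (i + 1) ^ 2 / lam ^ (i + 1)) ^ 2 * m (i + 1) ^ 2 := by
      ring
    simp only [e1, e2]
    have := mul_le_mul_of_nonneg_left h1
      (by positivity : 0 ≤ 2 * ((4 : ℝ) ^ (i + 1) ^ 2 / lam ^ (i + 1)) ^ 2)
    linarith
  · simpa using! h0.trans (le_mul_of_one_le_left hB (one_le_pow₀ (by norm_num : (1 : ℝ) ≤ 4)))
  · gcongr
    exact (div_le_iff₀ (by positivity)).2 hn

end Interpolation

section CauchyEvaluation

/-- The boundary parametrisation `t ↦ r e^{it}` of the closed disc. -/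
noncomputable def boundaryMap (r : ℝ) (hr : 0 ≤ r) : C(Icc (0 : ℝ) (2 * π), OmDom r) where
  toFun t := ⟨circleMap 0 r t, circleMap_mem_closedBall 0 hr t⟩
  continuous_toFun := by fun_prop

/-- Lebesgue measure on the subtype `[0, 2π]`. -/
noncomputable def volumeIcc : Measure (Icc (0 : ℝ) (2 * π)) :=
  (volume.restrict (Icc (0 : ℝ) (2 * π))).comap Subtype.val

instance : IsFiniteMeasure volumeIcc :=
  inferInstanceAs (IsFiniteMeasure ((volume.restrict (Icc (0 : ℝ) (2 * π))).comap Subtype.val))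

/-- Integration over `[0, 2π]` as a continuous linear functional on continuous functions. -/
noncomputable def integralIccCLM : C(Icc (0 : ℝ) (2 * π), ℂ) →L[ℝ] ℂ :=
  LinearMap.mkContinuous
    { toFun := fun h => ∫ t, h t ∂volumeIcc
      map_add' := fun h k => integral_add
        (h.continuous.integrable_of_hasCompactSupport (HasCompactSupport.of_compactSpace _))
        (k.continuous.integrable_of_hasCompactSupport (HasCompactSupport.of_compactSpace _))
      map_smul' := fun c _ => integral_smul c _ }
    (volumeIcc.real univ)
    fun h => (norm_integral_le_of_norm_le_const (ae_of_all _ h.norm_coe_le_norm)).trans_eq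
      (mul_comm _ _)

/-- Evaluation at points of the open disc depends smoothly on the point, when expressed through
Cauchy's integral formula. -/
theorem exists_contDiffOn_evaluation {r : ℝ} (hr : 0 < r) :
    ∃ G : ℂ → (Om r →L[ℝ] ℂ), ContDiffOn ℝ (⊤ : ℕ∞) G (ball 0 r) ∧
      ∀ g : Om r, HolOm g → ∀ z ∈ ball (0 : ℂ) r, G z g = evOm g z := by
  have hw : ∀ t : ℝ, circleMap 0 r t ≠ 0 := fun t => circleMap_ne_center hr.ne'
  let e : C(Icc (0 : ℝ) (2 * π), ℂ) :=
    ⟨fun t => (circleMap 0 r t)⁻¹, Continuous.inv₀ (by fun_prop) fun t => hw t⟩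
  let P : Om r →L[ℝ] C(Icc (0 : ℝ) (2 * π), ℂ) :=
    ⟨(ContinuousMap.compRightAlgHom ℝ ℂ (boundaryMap r hr.le)).toLinearMap,
      ContinuousMap.compRightAlgHom_continuous ℝ ℂ _⟩
  have hne : ∀ z ∈ ball (0 : ℂ) r, ∀ t : ℝ, 1 - z * (circleMap 0 r t)⁻¹ ≠ 0 := by
    intro z hz t h
    have h1 : z = circleMap 0 r t := by
      rw [sub_eq_zero, ← div_eq_mul_inv, eq_comm, div_eq_one_iff_eq (hw t)] at h
      exact h
    have h2 : circleMap 0 r t ∈ sphere (0 : ℂ) r := circleMap_mem_sphere 0 hr.le t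
    rw [mem_sphere_zero_iff_norm] at h2
    rw [mem_ball_zero_iff, h1, h2] at hz
    exact lt_irrefl _ hz
  have hunit : ∀ z ∈ ball (0 : ℂ) r, IsUnit (1 - z • e) := fun z hz =>
    ContinuousMap.isUnit_iff_forall_ne_zero _ |>.2 fun t => hne z hz t
  refine ⟨fun z => (2 * π)⁻¹ • (integralIccCLM ∘L
    (ContinuousLinearMap.mul ℝ _ (Ring.inverse (1 - z • e))) ∘L P), ?_, ?_⟩
  · intro z hz
    obtain ⟨v, hv⟩ := hunit z hz
    have h1 : ContDiffAt ℝ (⊤ : ℕ∞) (fun z : ℂ => 1 - z • e) z := by fun_prop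
    have h2 : ContDiffAt ℝ (⊤ : ℕ∞) (fun z : ℂ => Ring.inverse (1 - z • e)) z := by
      have h3 := contDiffAt_ringInverse ℝ (n := (⊤ : ℕ∞)) v
      rw [hv] at h3
      exact h3.comp z h1
    have h4 : ContDiffAt ℝ (⊤ : ℕ∞)
        (fun z : ℂ => ContinuousLinearMap.mul ℝ _ (Ring.inverse (1 - z • e))) z :=
      (ContinuousLinearMap.contDiff _).contDiffAt.comp z h2
    exact ((contDiffAt_const.clm_comp (h4.clm_comp contDiffAt_const)).const_smul _).contDiffWithinAt
  · intro g hg z hz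
    have hcont : ContinuousOn (evOm g) (closedBall 0 r) := by
      rw [continuousOn_iff_continuous_domRestrict]
      convert g.continuous using 1
      ext x
      simp [evOm]
    have hcauchy := two_pi_I_inv_smul_circleIntegral_sub_inv_smul_of_differentiable_on_off_countable
      countable_empty hz hcont fun x hx =>
        hg.differentiableAt (isOpen_ball.mem_nhds hx.1)
    rw [← hcauchy]
    have hinv : ∀ t : Icc (0 : ℝ) (2 * π),
        Ring.inverse (1 - z • e) t = (1 - z * (circleMap 0 r t)⁻¹)⁻¹ := by
      intro t
      have := congrArg (fun h : C(Icc (0 : ℝ) (2 * π), ℂ) => h t)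
        (Ring.inverse_mul_cancel _ (hunit z hz))
      exact eq_inv_of_mul_eq_one_left this
    have hint : integralIccCLM (Ring.inverse (1 - z • e) * P g) =
        ∫ t in (0 : ℝ)..(2 * π), (1 - z * (circleMap 0 r t)⁻¹)⁻¹ * evOm g (circleMap 0 r t) := by
      rw [intervalIntegral.integral_of_le (by positivity), ← integral_Icc_eq_integral_Ioc,
        ← Measure.restrict_restrict_of_subset (Subset.refl (Icc (0 : ℝ) (2 * π))),
        ← integral_subtype_comap measurableSet_Icc]
      refine integral_congr_ae (μ := volumeIcc) (ae_of_all _ fun t => ?_)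
      have h1 : evOm g (circleMap 0 r t) = P g t :=
        dif_pos (circleMap_mem_closedBall 0 hr.le t)
      simp only [h1, ← hinv]
      rfl
    change (2 * π)⁻¹ • integralIccCLM (Ring.inverse (1 - z • e) * P g) = _
    rw [hint, circleIntegral]
    have hkernel : ∀ t : ℝ, deriv (circleMap 0 r) t • ((circleMap 0 r t - z)⁻¹ •
        evOm g (circleMap 0 r t)) =
        I * ((1 - z * (circleMap 0 r t)⁻¹)⁻¹ * evOm g (circleMap 0 r t)) := by
      intro t
      have h1 := hw t
      have h2 : (1 - z * (circleMap 0 r t)⁻¹)⁻¹ =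
          circleMap 0 r t * (circleMap 0 r t - z)⁻¹ := by
        rw [← div_eq_mul_inv, one_sub_div h1, inv_div, div_eq_mul_inv]
      rw [deriv_circleMap, h2, smul_eq_mul, smul_eq_mul]
      ring
    simp only [hkernel]
    rw [intervalIntegral.integral_const_mul, Complex.real_smul, smul_eq_mul]
    push_cast
    field_simp

end CauchyEvaluation

theorem exists_norm_iteratedFDerivWithin_le {E F : Type*} [NormedAddCommGroup E] [NormedSpace ℝ E]
    [NormedAddCommGroup F] [NormedSpace ℝ F] {G : E → F} {s K : Set E} (hs : IsOpen s)
    (hG : ContDiffOn ℝ (⊤ : ℕ∞) G s) (hK : IsCompact K) (hKs : K ⊆ s) (n : ℕ) :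
    ∃ C : ℝ, 0 ≤ C ∧ ∀ i ≤ n, ∀ x ∈ K, ‖iteratedFDerivWithin ℝ i G s x‖ ≤ C := by
  have h : ∀ i : ℕ, ∃ C : ℝ, ∀ x ∈ K, ‖iteratedFDerivWithin ℝ i G s x‖ ≤ C := fun i =>
    hK.exists_bound_of_continuousOn
      ((hG.continuousOn_iteratedFDerivWithin (by exact_mod_cast le_top) hs.uniqueDiffOn).mono hKs)
  choose C hC using h
  refine ⟨∑ i ∈ Finset.range (n + 1), |C i|, Finset.sum_nonneg fun _ _ => abs_nonneg _,
    fun i hi x hx => (hC i x hx).trans ((le_abs_self _).trans ?_)⟩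
  exact Finset.single_le_sum (f := fun i => |C i|) (fun _ _ => abs_nonneg _)
    (Finset.mem_range.2 (by omega))

theorem exists_one_le_pow_le {A : ℝ} (hA : 1 ≤ A) (n : ℕ) :
    ∃ lam : ℝ, 1 ≤ lam ∧ lam ^ n ≤ A ∧ (n ≠ 0 → A ≤ lam ^ n) := by
  rcases eq_or_ne n 0 with rfl | hn
  · exact ⟨1, le_rfl, by simpa using hA, fun h => absurd rfl h⟩
  · have h := Real.rpow_inv_natCast_pow (zero_le_one.trans hA) hn
    exact ⟨A ^ (n⁻¹ : ℝ), Real.one_le_rpow hA (by positivity), h.le, fun _ => h.ge⟩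

/-- tame estimate for the composition operator (f,u) ↦ (θ ↦ f(θ,u(θ))), for
smooth maps f : 𝕋¹ → Ω(closure D(0,r)) with ‖f‖₀ ≤ M (fibers holomorphic), r ∈ (1/2,1],
and smooth curves u with ‖u‖₀ < 1/2. -/
theorem composition_tame_estimate
    (M r : ℝ) (hM : 0 < M) (hr1 : 1 / 2 < r) (hr2 : r ≤ 1) (n : ℕ) :
    ∃ D : ℝ, 0 < D ∧
      ∀ f : ℝ → Om r, SmoothPer f → (∀ θ, HolOm (f θ)) → cNorm 0 f ≤ M →
        ∀ u : ℝ → ℂ, SmoothPer u → cNorm 0 u < 1 / 2 →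
          ContDiff ℝ (⊤ : ℕ∞) (fun θ => evOm (f θ) (u θ)) ∧
          cNorm n (fun θ => evOm (f θ) (u θ)) ≤ D * (1 + cNorm n f + cNorm n u) := by
  have hr : 0 < r := by linarith
  obtain ⟨G, hG, hGev⟩ := exists_contDiffOn_evaluation hr
  obtain ⟨C, hC0, hC⟩ := exists_norm_iteratedFDerivWithin_le isOpen_ball hG
    (isCompact_closedBall (0 : ℂ) (1 / 2)) (closedBall_subset_ball hr1) n
  set Q : ℝ := 4 ^ n ^ 2
  have hQ1 : 1 ≤ Q := one_le_pow₀ (by norm_num)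
  set D : ℝ := ∑ k ∈ Finset.range (n + 1), ∑ i ∈ Finset.range (k + 1),
    (k.choose i : ℝ) * (i.factorial * C * Q ^ i) * (Q * (M + 1)) with hD
  have hD0 : 0 ≤ D := by positivity
  refine ⟨D + 1, by positivity, fun f hf hhol hfM u hu hu2 => ?_⟩
  have hcN : ∀ {E : Type} [NormedAddCommGroup E] [NormedSpace ℝ E] (g : ℝ → E),
      cNorm 0 g = ⨆ θ, ‖iteratedDeriv 0 g θ‖ := fun g => by simp [cNorm]
  have hu' : ∀ θ, u θ ∈ closedBall (0 : ℂ) (1 / 2) := fun θ => by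
    have := hu.norm_iteratedDeriv_le_iSup 0 θ
    rw [← hcN, iteratedDeriv_zero] at this
    rw [mem_closedBall_zero_iff]
    linarith
  have hub : ∀ θ, u θ ∈ ball (0 : ℂ) r := fun θ => closedBall_subset_ball hr1 (hu' θ)
  have hGu : ContDiff ℝ (⊤ : ℕ∞) (G ∘ u) :=
    contDiffOn_univ.1 (hG.comp hu.1.contDiffOn fun θ _ => hub θ)
  have hF : (fun θ => evOm (f θ) (u θ)) = fun θ => (G ∘ u) θ (f θ) :=
    funext fun θ => (hGev _ (hhol θ) _ (hub θ)).symm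
  rw [hF]
  refine ⟨hGu.clm_apply hf.1, ?_⟩
  set A : ℝ := 1 + cNorm n f + cNorm n u with hA
  have hfn := cNorm_nonneg n f
  have hun := cNorm_nonneg n u
  obtain ⟨lam, hlam, hlamA, hAlam⟩ := exists_one_le_pow_le (by linarith : 1 ≤ A) n
  have hlam0 : 0 < lam := by linarith
  have hfi : ∀ i ≤ n, ∀ θ, ‖iteratedFDeriv ℝ i f θ‖ ≤ Q * (M + 1) * lam ^ i := by
    intro i hi θ
    rw [norm_iteratedFDeriv_eq_norm_iteratedDeriv]
    have h0 : ⨆ θ, ‖iteratedDeriv 0 f θ‖ ≤ M + 1 := by rw [← hcN]; linarith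
    refine hf.norm_iteratedDeriv_le_of_endpoints hlam h0 ?_ hi θ
    rcases eq_or_ne n 0 with rfl | hn
    · simpa using h0
    · have h1 := iSup_norm_iteratedDeriv_le_cNorm n f
      have h2 := hAlam hn
      exact (by linarith : _ ≤ lam ^ n).trans (le_mul_of_one_le_left (by positivity) (by linarith))
  have hui : ∀ i, 1 ≤ i → i ≤ n → ∀ θ, ‖iteratedFDeriv ℝ i u θ‖ ≤ (Q * lam) ^ i := by
    intro i hi1 hi θ
    rw [norm_iteratedFDeriv_eq_norm_iteratedDeriv]
    have h0 : ⨆ θ, ‖iteratedDeriv 0 u θ‖ ≤ 1 := by rw [← hcN]; linarith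
    have h1 := iSup_norm_iteratedDeriv_le_cNorm n u
    have h2 := hAlam (by omega)
    refine (hu.norm_iteratedDeriv_le_of_endpoints hlam h0 (by linarith) hi θ).trans ?_
    rw [mul_one, mul_pow]
    gcongr
    exact le_self_pow₀ hQ1 (by omega)
  have hGui : ∀ i ≤ n, ∀ θ, ‖iteratedFDeriv ℝ i (G ∘ u) θ‖ ≤
      i.factorial * C * Q ^ i * lam ^ i := by
    intro i hi θ
    rw [mul_assoc _ (Q ^ i), ← mul_pow, ← iteratedFDerivWithin_univ]
    refine norm_iteratedFDerivWithin_comp_le hG hu.1.contDiffOn (by exact_mod_cast le_top)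
      isOpen_ball.uniqueDiffOn uniqueDiffOn_univ (fun θ _ => hub θ) (mem_univ θ)
      (fun j hj => hC j (hj.trans hi) _ (hu' θ)) fun j hj1 hj => ?_
    rw [iteratedFDerivWithin_univ]
    exact hui j hj1 (hj.trans hi) θ
  have hmain : cNorm n (fun θ => (G ∘ u) θ (f θ)) ≤ D * A := by
    rw [cNorm, hD, Finset.sum_mul]
    refine Finset.sum_le_sum fun k hk => ciSup_le fun θ => ?_
    have hkn : k ≤ n := Nat.lt_succ_iff.1 (Finset.mem_range.1 hk)
    rw [← norm_iteratedFDeriv_eq_norm_iteratedDeriv, Finset.sum_mul]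
    refine (norm_iteratedFDeriv_clm_apply hGu hf.1 θ (by exact_mod_cast le_top)).trans
      (Finset.sum_le_sum fun i hi => ?_)
    have hik : i ≤ k := Nat.lt_succ_iff.1 (Finset.mem_range.1 hi)
    have hsplit : lam ^ i * lam ^ (k - i) ≤ A := by
      rw [← pow_add, Nat.add_sub_cancel' hik]
      exact (pow_le_pow_right₀ hlam hkn).trans hlamA
    calc _ ≤ (k.choose i : ℝ) * (i.factorial * C * Q ^ i * lam ^ i) *
          (Q * (M + 1) * lam ^ (k - i)) := by
          gcongr
          · exact hGui i (hik.trans hkn) θ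
          · exact hfi (k - i) (by omega) θ
      _ = (k.choose i : ℝ) * (i.factorial * C * Q ^ i) * (Q * (M + 1)) *
          (lam ^ i * lam ^ (k - i)) := by ring
      _ ≤ _ := by gcongr
  nlinarith
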